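/- arXiv:0710.3777 — 10 statements merged into one kernel-verified Lean document; each statement's English description precedes it below -/
import Mathlib

section
/- Let h_SD, h_SR, h_RD be nonnegative real numbers and let ρ be any real number with -1 ≤ ρ ≤ 1. Then min( log₂(1 + (1-ρ²)(h_SD² + h_SR²)), log₂(1 + h_SD² + h_RD² + 2ρ·h_SD·h_RD) ) ≤ max( log₂(1 + h_SD²), min( log₂(1 + h_SR²), log₂(1 + h_SD² + h_RD²) ) ) + 1. (That is, the decode-and-forward achievable rate R_DF of the Gaussian relay channel is within one bit of the cut-set upper bound, for all values of the channel gains.) -/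
/-- If `x ≤ 2 * y` then the binary logarithms of `x` and `y` differ by at most one. -/
theorem logb_two_le_logb_two_add_one {x y : ℝ} (hx : 0 < x) (hxy : x ≤ 2 * y) :
    Real.logb 2 x ≤ Real.logb 2 y + 1 := by
  have hy : 0 < y := by linarith
  calc Real.logb 2 x ≤ Real.logb 2 (y * 2) :=
        Real.logb_le_logb_of_le one_lt_two hx (by linarith)
    _ = Real.logb 2 y + 1 := by
        rw [Real.logb_mul hy.ne' two_ne_zero, Real.logb_self_eq_one one_lt_two]


/-- The decode-and-forward achievable rate of the Gaussian relay channel is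
within one bit of the cut-set upper bound, for all channel gains. -/
theorem relay_decode_forward_within_one_bit
    (h_SD h_SR h_RD ρ : ℝ)
    (hSD : 0 ≤ h_SD) (hSR : 0 ≤ h_SR) (hRD : 0 ≤ h_RD)
    (hρ₁ : -1 ≤ ρ) (hρ₂ : ρ ≤ 1) :
    min (Real.logb 2 (1 + (1 - ρ ^ 2) * (h_SD ^ 2 + h_SR ^ 2)))
        (Real.logb 2 (1 + h_SD ^ 2 + h_RD ^ 2 + 2 * ρ * h_SD * h_RD))
      ≤ max (Real.logb 2 (1 + h_SD ^ 2))
          (min (Real.logb 2 (1 + h_SR ^ 2))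
            (Real.logb 2 (1 + h_SD ^ 2 + h_RD ^ 2))) + 1 := by
  have hρ : 0 ≤ 1 - ρ ^ 2 := by nlinarith
  have hpos : 0 < 1 + (1 - ρ ^ 2) * (h_SD ^ 2 + h_SR ^ 2) := by positivity
  have hle : (1 - ρ ^ 2) * (h_SD ^ 2 + h_SR ^ 2) ≤ h_SD ^ 2 + h_SR ^ 2 :=
    mul_le_of_le_one_left (by positivity) (by linarith [sq_nonneg ρ])
  have hab : 0 ≤ h_SD * h_RD := mul_nonneg hSD hRD
  rcases le_total h_SR h_SD with h | h
  · have hsq : h_SR ^ 2 ≤ h_SD ^ 2 := pow_le_pow_left₀ hSR h 2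
    exact (min_le_left _ _).trans <|
      (logb_two_le_logb_two_add_one hpos (by linarith)).trans <|
        add_le_add_left (le_max_left _ _) 1
  · have hsq : h_SD ^ 2 ≤ h_SR ^ 2 := pow_le_pow_left₀ hSD h 2
    refine le_trans ?_ (add_le_add_left (le_max_right _ _) 1)
    rw [← min_add_add_right]
    refine min_le_min (logb_two_le_logb_two_add_one hpos (by linarith))
      (logb_two_le_logb_two_add_one ?_ ?_)
    · nlinarith [mul_nonneg (by linarith : 0 ≤ 1 + ρ) hab, sq_nonneg (h_SD - h_RD)]
    · nlinarith [mul_nonneg (by linarith : 0 ≤ 1 - ρ) hab, sq_nonneg (h_SD - h_RD)]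
end

section
/- Let g₁, g₂, d₁, d₂ be nonnegative real numbers with g₁ ≥ g₂. If the pair (R₁, R₂) belongs to the region 𝓡, then (R₁, R₂) also belongs to the region 𝓡*. In other words, 𝓡 ⊆ 𝓡*. -/
/-- The region 𝓡: intersection of the BC region from the source to the relays
and the MAC region from the relays to the destination. -/
def diamondR (g₁ g₂ d₁ d₂ : ℝ) : Set (ℝ × ℝ) :=
  {p | ∃ α : ℝ, 0 ≤ α ∧ α ≤ 1 ∧
    0 ≤ p.1 ∧ p.1 ≤ Real.logb 2 (1 + α * g₁) ∧
    0 ≤ p.2 ∧ p.2 ≤ Real.logb 2 (1 + (1 - α) * g₂ / (α * g₂ + 1)) ∧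
    p.1 ≤ Real.logb 2 (1 + d₁) ∧ p.2 ≤ Real.logb 2 (1 + d₂) ∧
    p.1 + p.2 ≤ Real.logb 2 (1 + d₁ + d₂)}

/-- The relaxed region 𝓡*. -/
def diamondRstar (g₁ g₂ d₁ d₂ : ℝ) : Set (ℝ × ℝ) :=
  {p | 0 ≤ p.1 ∧ 0 ≤ p.2 ∧ p.2 ≤ Real.logb 2 (1 + g₂) ∧
    p.1 + p.2 ≤ Real.logb 2 (1 + g₁) ∧
    p.1 ≤ Real.logb 2 (1 + d₁) ∧ p.2 ≤ Real.logb 2 (1 + d₂) ∧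
    p.1 + p.2 ≤ Real.logb 2 (1 + d₁ + d₂)}

/-- The weaker receiver's signal-to-interference ratio as a quotient of total powers. -/
theorem one_add_sinr_eq_div {α g : ℝ} (h : 0 ≤ α * g) :
    1 + (1 - α) * g / (α * g + 1) = (1 + g) / (1 + α * g) := by
  have : α * g + 1 ≠ 0 := by positivity
  rw [add_comm 1 (α * g)]
  field_simp
  ring

/-- 𝓡 ⊆ 𝓡*. -/
theorem diamondR_subset_Rstar
    (g₁ g₂ d₁ d₂ : ℝ) (hg₂ : 0 ≤ g₂) (hg : g₂ ≤ g₁) (hd₁ : 0 ≤ d₁) (hd₂ : 0 ≤ d₂) :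
    diamondR g₁ g₂ d₁ d₂ ⊆ diamondRstar g₁ g₂ d₁ d₂ := by
  rintro ⟨R₁, R₂⟩ ⟨α, hα₀, hα₁, hR₁, hBC₁, hR₂, hBC₂, hMAC₁, hMAC₂, hMAC⟩
  dsimp only at *
  have hg₁ : 0 ≤ g₁ := hg₂.trans hg
  have hα₂ : 0 ≤ α * g₂ := mul_nonneg hα₀ hg₂
  rw [one_add_sinr_eq_div hα₂] at hBC₂
  refine ⟨hR₁, hR₂, hBC₂.trans ?_, (add_le_add hBC₁ hBC₂).trans ?_, hMAC₁, hMAC₂, hMAC⟩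
  · exact Real.logb_le_logb_of_le one_lt_two (by positivity)
      (div_le_self (by positivity) (by linarith))
  · rw [← Real.logb_mul (by positivity) (by positivity)]
    refine Real.logb_le_logb_of_le one_lt_two (by positivity) ?_
    rw [← mul_div_assoc, div_le_iff₀ (by positivity)]
    linarith [mul_nonneg (sub_nonneg.2 hα₁) (sub_nonneg.2 hg)]
end

section
/- Let g₁, g₂, d₁, d₂ be nonnegative real numbers with g₁ ≥ g₂. If the pair (R₁*, R₂*) belongs to the region 𝓡*, then the pair (R₁*, max(R₂* - 1, 0)) belongs to the region 𝓡. -/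
/-- Superposition coding with the power split `α * g₁ = x - 1` loses at most a factor `2` on the
second user, compared with the relaxed constraints `y ≤ 1 + g₂` and `x * y ≤ 1 + g₁`. -/
theorem exists_power_split {g₁ g₂ x y : ℝ} (hg₂ : 0 ≤ g₂) (hg : g₂ ≤ g₁) (hx : 1 ≤ x)
    (hy : 1 ≤ y) (hyg : y ≤ 1 + g₂) (hxy : x * y ≤ 1 + g₁) :
    ∃ α : ℝ, 0 ≤ α ∧ α ≤ 1 ∧ x ≤ 1 + α * g₁ ∧
      y / 2 ≤ 1 + (1 - α) * g₂ / (α * g₂ + 1) := by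
  have hxg : x ≤ 1 + g₁ := by nlinarith
  obtain ⟨α, hα₀, hα₁, hα⟩ : ∃ α : ℝ, 0 ≤ α ∧ α ≤ 1 ∧ α * g₁ = x - 1 := by
    rcases (hg₂.trans hg).eq_or_lt with h | h
    · exact ⟨0, le_rfl, zero_le_one, by linarith⟩
    · exact ⟨(x - 1) / g₁, div_nonneg (by linarith) h.le, (div_le_one h).2 (by linarith),
        div_mul_cancel₀ _ h.ne'⟩
  refine ⟨α, hα₀, hα₁, by linarith, ?_⟩
  have hαg : 0 < α * g₂ + 1 := by positivity
  have hyα : y * (α * g₂) ≤ g₂ := by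
    rcases (hg₂.trans hg).eq_or_lt with h | h
    · have : g₂ = 0 := by linarith
      simp [this]
    · refine le_of_mul_le_mul_right ?_ h
      calc y * (α * g₂) * g₁ = (x * y - y) * g₂ := by linear_combination y * g₂ * hα
        _ ≤ g₁ * g₂ := by gcongr; linarith
        _ = g₂ * g₁ := mul_comm _ _
  have key : 1 + (1 - α) * g₂ / (α * g₂ + 1) = (1 + g₂) / (α * g₂ + 1) := by
    field_simp
    ring
  rw [key, le_div_iff₀ hαg]
  linarith

/-- If (R₁*, R₂*) ∈ 𝓡*, then (R₁*, (R₂* - 1)⁺) ∈ 𝓡. -/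
theorem diamondRstar_one_bit_into_R
    (g₁ g₂ d₁ d₂ : ℝ) (hg₂ : 0 ≤ g₂) (hg : g₂ ≤ g₁) (hd₁ : 0 ≤ d₁) (hd₂ : 0 ≤ d₂)
    (R₁ R₂ : ℝ) (hmem : (R₁, R₂) ∈ diamondRstar g₁ g₂ d₁ d₂) :
    (R₁, max (R₂ - 1) 0) ∈ diamondR g₁ g₂ d₁ d₂ := by
  obtain ⟨h₁, h₂, h₂g, h₁₂g, h₁d, h₂d, h₁₂d⟩ := hmem
  dsimp only at h₁ h₂ h₂g h₁₂g h₁d h₂d h₁₂d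
  have hmax : max (R₂ - 1) 0 ≤ R₂ := max_le (by linarith) h₂
  have h2 : (1 : ℝ) < 2 := one_lt_two
  rw [Real.le_logb_iff_rpow_le h2 (by linarith)] at h₂g h₁₂g
  rw [Real.rpow_add two_pos] at h₁₂g
  obtain ⟨α, hα₀, hα₁, hx, hy⟩ := exists_power_split hg₂ hg
    (Real.one_le_rpow h2.le h₁) (Real.one_le_rpow h2.le h₂) h₂g h₁₂g
  have hg₁ : 0 ≤ g₁ := hg₂.trans hg
  have hfrac : 0 ≤ (1 - α) * g₂ / (α * g₂ + 1) :=
    div_nonneg (mul_nonneg (by linarith) hg₂) (by positivity)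
  refine ⟨α, hα₀, hα₁, h₁, ?_, le_max_right _ _, max_le ?_ ?_, h₁d, hmax.trans h₂d, ?_⟩
  · exact (Real.le_logb_iff_rpow_le h2 (by positivity)).2 hx
  · rw [Real.le_logb_iff_rpow_le h2 (by linarith), Real.rpow_sub_one two_ne_zero]
    exact hy
  · exact Real.logb_nonneg h2 (by linarith)
  · exact (add_le_add le_rfl hmax).trans h₁₂d
end

section
/- Let r, s, t be real numbers with r > 1, s ≥ 2^r − 1, and t ≥ s. Define α* = (1 + s − 2^{r−1}) / (2^{r−1}·s). Then: (i) 0 ≤ α* ≤ 1; (ii) log₂(1 + (1 − α*)·s / (α*·s + 1)) = r − 1; and (iii) α* ≥ (1 + t) / (2^r · t), so that log₂(1 + α*·t) ≥ log₂( (1 + t) / 2^r ) = log₂(1 + t) − r. -/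
/-- The broadcast power split `a = (1 + s - p) / (p * s)` gives the weak user the
signal-to-interference factor `p`. -/
theorem one_add_power_split_sinr {p s : ℝ} (hp : p ≠ 0) (hs : s ≠ 0) (hs1 : 1 + s ≠ 0) :
    1 + (1 - (1 + s - p) / (p * s)) * s / ((1 + s - p) / (p * s) * s + 1) = p := by
  have h : (1 + s - p) / (p * s) * s + 1 = (1 + s) / p := by
    field_simp
    ring
  rw [h]
  field_simp
  ring

theorem le_power_split {p s t : ℝ} (hp : 0 < p) (hs0 : 0 < s) (hs : 2 * p ≤ 1 + s)
    (hts : s ≤ t) : (1 + t) / (2 * p * t) ≤ (1 + s - p) / (p * s) := by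
  have ht : 0 < t := hs0.trans_le hts
  rw [div_le_div_iff₀ (by positivity) (by positivity)]
  have h : (1 + t) * s ≤ (1 + s - p) * (2 * t) := by nlinarith
  nlinarith

/-- Properties of the power-split parameter `α* = (1 + s - 2^(r-1)) / (2^(r-1) * s)`
of the superposition broadcast code in the Gaussian diamond network. -/
theorem diamond_power_split
    (r s t : ℝ) (hr : 1 < r) (hs : (2 : ℝ) ^ r - 1 ≤ s) (hts : s ≤ t) :
    0 ≤ (1 + s - (2 : ℝ) ^ (r - 1)) / ((2 : ℝ) ^ (r - 1) * s) ∧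
    (1 + s - (2 : ℝ) ^ (r - 1)) / ((2 : ℝ) ^ (r - 1) * s) ≤ 1 ∧
    Real.logb 2 (1 + (1 - (1 + s - (2 : ℝ) ^ (r - 1)) / ((2 : ℝ) ^ (r - 1) * s)) * s /
        ((1 + s - (2 : ℝ) ^ (r - 1)) / ((2 : ℝ) ^ (r - 1) * s) * s + 1)) = r - 1 ∧
    (1 + t) / ((2 : ℝ) ^ r * t) ≤ (1 + s - (2 : ℝ) ^ (r - 1)) / ((2 : ℝ) ^ (r - 1) * s) ∧
    Real.logb 2 ((1 + t) / (2 : ℝ) ^ r) = Real.logb 2 (1 + t) - r ∧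
    Real.logb 2 (1 + t) - r ≤
      Real.logb 2 (1 + (1 + s - (2 : ℝ) ^ (r - 1)) / ((2 : ℝ) ^ (r - 1) * s) * t) := by
  have hp1 : 1 < (2 : ℝ) ^ (r - 1) := Real.one_lt_rpow one_lt_two (sub_pos.2 hr)
  have h2 : (2 : ℝ) ^ r = 2 * (2 : ℝ) ^ (r - 1) := by
    rw [Real.rpow_sub_one two_ne_zero]
    ring
  have hlog : Real.logb 2 ((2 : ℝ) ^ (r - 1)) = r - 1 :=
    Real.logb_rpow two_pos (by norm_num)
  have hdiv : Real.logb 2 ((1 + t) / (2 : ℝ) ^ r) = Real.logb 2 (1 + t) - r := by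
    rw [Real.logb_div (by linarith) (by positivity), Real.logb_rpow two_pos (by norm_num)]
  rw [← hdiv, h2]
  rw [h2] at hs
  generalize (2 : ℝ) ^ (r - 1) = p at *
  have hp : 0 < p := one_pos.trans hp1
  have hs0 : 0 < s := by linarith
  have ht : 0 < t := hs0.trans_le hts
  have hsplit := le_power_split hp hs0 (by linarith) hts
  refine ⟨?_, ?_, ?_, hsplit, rfl, ?_⟩
  · exact div_nonneg (by linarith) (by positivity)
  · rw [div_le_one (by positivity)]
    nlinarith
  · rw [one_add_power_split_sinr hp.ne' hs0.ne' (by positivity), hlog]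
  · have h := mul_le_mul_of_nonneg_right hsplit ht.le
    have h' : (1 + t) / (2 * p * t) * t = (1 + t) / (2 * p) := by field_simp
    exact Real.logb_le_logb_of_le one_lt_two (by positivity) (by linarith)
end

section
/- Let g₁, g₂, d₁, d₂ be nonnegative real numbers with g₁ ≥ g₂. Define R_PDF = sup { R₁ + R₂ : (R₁, R₂) ∈ 𝓡 } and R* = sup { R₁ + R₂ : (R₁, R₂) ∈ 𝓡* }. Then 0 ≤ R* − R_PDF ≤ 1. -/
lemma diamondR_subset_diamondRstar {g₁ g₂ : ℝ} (d₁ d₂ : ℝ) (hg₂ : 0 ≤ g₂) (hg : g₂ ≤ g₁) :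
    diamondR g₁ g₂ d₁ d₂ ⊆ diamondRstar g₁ g₂ d₁ d₂ := by
  rintro ⟨r₁, r₂⟩ ⟨α, hα₀, hα₁, h₁, h₁', h₂, h₂', h₃, h₄, h₅⟩
  dsimp only at *
  have hg₁ : 0 ≤ g₁ := hg₂.trans hg
  have hαg₂ : 0 < α * g₂ + 1 := by positivity
  have hfrac : 1 + (1 - α) * g₂ / (α * g₂ + 1) = (1 + g₂) / (α * g₂ + 1) := by
    field_simp
    ring
  rw [hfrac] at h₂'
  refine ⟨h₁, h₂, h₂'.trans ?_, ?_, h₃, h₄, h₅⟩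
  · refine Real.logb_le_logb_of_le one_lt_two (by positivity) (div_le_self (by positivity) ?_)
    exact le_add_of_nonneg_left (by positivity)
  · calc r₁ + r₂ ≤ Real.logb 2 (1 + α * g₁) + Real.logb 2 ((1 + g₂) / (α * g₂ + 1)) :=
          add_le_add h₁' h₂'
      _ = Real.logb 2 ((1 + α * g₁) * ((1 + g₂) / (α * g₂ + 1))) :=
          (Real.logb_mul (by positivity) (by positivity)).symm
      _ ≤ Real.logb 2 (1 + g₁) := by
          refine Real.logb_le_logb_of_le one_lt_two (by positivity) ?_
          rw [mul_div_assoc', div_le_iff₀ hαg₂]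
          nlinarith [mul_nonneg (sub_nonneg.2 hα₁) (sub_nonneg.2 hg)]

/-- Giving up at most one bit of the second rate moves a point of `𝓡*` into `𝓡`; the power
fraction `α = 2 ^ (-R₂)` is a witness. -/
lemma mem_diamondR_of_mem_diamondRstar {g₁ g₂ d₁ d₂ : ℝ} (hg₂ : 0 ≤ g₂) (hg : g₂ ≤ g₁)
    {p : ℝ × ℝ} (hp : p ∈ diamondRstar g₁ g₂ d₁ d₂) :
    (p.1, max (p.2 - 1) 0) ∈ diamondR g₁ g₂ d₁ d₂ := by
  obtain ⟨r₁, r₂⟩ := p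
  obtain ⟨h₁, h₂, hrate, hsum, h₃, h₄, h₅⟩ := hp
  dsimp only at *
  have hg₁ : 0 ≤ g₁ := hg₂.trans hg
  have hle : max (r₂ - 1) 0 ≤ r₂ := max_le (by linarith) h₂
  set y : ℝ := 2 ^ r₂ with hy
  have hy1 : 1 ≤ y := Real.one_le_rpow one_le_two h₂
  have hy0 : 0 < y := by positivity
  have hyg : y ≤ 1 + g₂ :=
    (Real.le_logb_iff_rpow_le one_lt_two (by positivity)).1 hrate
  have hy' : y⁻¹ ≤ 1 := inv_le_one_of_one_le₀ hy1
  have hfrac : 1 + (1 - y⁻¹) * g₂ / (y⁻¹ * g₂ + 1) = y * (1 + g₂) / (y + g₂) := by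
    field_simp
    ring
  refine ⟨y⁻¹, by positivity, hy', h₁, ?_, le_max_right _ _, max_le ?_ ?_, h₃,
    hle.trans h₄, by dsimp only; linarith⟩
  · rw [Real.le_logb_iff_rpow_le one_lt_two (by positivity)] at hsum ⊢
    rw [Real.rpow_add two_pos, ← hy, ← le_div_iff₀ hy0] at hsum
    calc (2 : ℝ) ^ r₁ ≤ (1 + g₁) / y := hsum
      _ = y⁻¹ + y⁻¹ * g₁ := by ring
      _ ≤ 1 + y⁻¹ * g₁ := by gcongr
  · rw [hfrac, Real.le_logb_iff_rpow_le one_lt_two (by positivity), Real.rpow_sub two_pos,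
      Real.rpow_one, ← hy, div_le_div_iff₀ two_pos (by positivity), mul_assoc]
    refine mul_le_mul_of_nonneg_left ?_ hy0.le
    linarith
  · refine Real.logb_nonneg one_lt_two (le_add_of_nonneg_right ?_)
    exact div_nonneg (mul_nonneg (sub_nonneg.2 hy') hg₂) (by positivity)

/-- The sum rates of 𝓡 and 𝓡* are within one bit of each other:
`0 ≤ R* - R_PDF ≤ 1`. -/
theorem diamond_sum_rate_gap
    (g₁ g₂ d₁ d₂ : ℝ) (hg₂ : 0 ≤ g₂) (hg : g₂ ≤ g₁) (hd₁ : 0 ≤ d₁) (hd₂ : 0 ≤ d₂) :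
    0 ≤ sSup ((fun p : ℝ × ℝ => p.1 + p.2) '' diamondRstar g₁ g₂ d₁ d₂) -
        sSup ((fun p : ℝ × ℝ => p.1 + p.2) '' diamondR g₁ g₂ d₁ d₂) ∧
    sSup ((fun p : ℝ × ℝ => p.1 + p.2) '' diamondRstar g₁ g₂ d₁ d₂) -
        sSup ((fun p : ℝ × ℝ => p.1 + p.2) '' diamondR g₁ g₂ d₁ d₂) ≤ 1 := by
  have hsub := diamondR_subset_diamondRstar d₁ d₂ hg₂ hg
  have hbdd : BddAbove ((fun p : ℝ × ℝ => p.1 + p.2) '' diamondRstar g₁ g₂ d₁ d₂) := by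
    refine ⟨Real.logb 2 (1 + g₁), ?_⟩
    rintro _ ⟨p, hp, rfl⟩
    exact hp.2.2.2.1
  have hzero : ((0 : ℝ), (0 : ℝ)) ∈ diamondRstar g₁ g₂ d₁ d₂ := by
    have hlog : ∀ x : ℝ, 0 ≤ x → 0 ≤ Real.logb 2 (1 + x) := fun x hx =>
      Real.logb_nonneg one_lt_two (le_add_of_nonneg_right hx)
    refine ⟨le_rfl, le_rfl, hlog _ hg₂, ?_, hlog _ hd₁, hlog _ hd₂, ?_⟩
    · simpa using hlog _ (hg₂.trans hg)
    · simpa [add_assoc] using hlog _ (add_nonneg hd₁ hd₂)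
  have hne : (diamondR g₁ g₂ d₁ d₂).Nonempty :=
    ⟨_, mem_diamondR_of_mem_diamondRstar hg₂ hg hzero⟩
  constructor
  · exact sub_nonneg.2 (csSup_le_csSup hbdd (hne.image _) (Set.image_mono hsub))
  · rw [sub_le_iff_le_add]
    refine csSup_le ⟨_, Set.mem_image_of_mem _ hzero⟩ ?_
    rintro _ ⟨p, hp, rfl⟩
    have hmem := le_csSup (hbdd.mono (Set.image_mono hsub))
      (Set.mem_image_of_mem (fun p : ℝ × ℝ => p.1 + p.2)
        (mem_diamondR_of_mem_diamondRstar hg₂ hg hp))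
    have hmax := le_max_left (p.2 - 1) 0
    dsimp only at hmem ⊢
    linarith
end

section
/- Let g₁, g₂, d₁, d₂ be nonnegative real numbers with g₁ ≥ g₂. Then there exists a pair (R₁, R₂) in the region 𝓡* with R₁ + R₂ ≥ min{ log₂(1 + max(g₁, g₂)), log₂(1 + d₁ + d₂), log₂(1 + g₁) + log₂(1 + d₂), log₂(1 + g₂) + log₂(1 + d₁) }. -/
/-- 𝓡* contains a rate pair whose sum is at least the min-cut value of the
corresponding deterministic diamond network. -/
theorem diamondRstar_achieves_min_cut
    (g₁ g₂ d₁ d₂ : ℝ) (hg₂ : 0 ≤ g₂) (hg : g₂ ≤ g₁) (hd₁ : 0 ≤ d₁) (hd₂ : 0 ≤ d₂) :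
    ∃ p ∈ diamondRstar g₁ g₂ d₁ d₂,
      min (min (Real.logb 2 (1 + max g₁ g₂)) (Real.logb 2 (1 + d₁ + d₂)))
          (min (Real.logb 2 (1 + g₁) + Real.logb 2 (1 + d₂))
            (Real.logb 2 (1 + g₂) + Real.logb 2 (1 + d₁)))
        ≤ p.1 + p.2 := by
  have hG₂ : 0 ≤ Real.logb 2 (1 + g₂) := Real.logb_nonneg one_lt_two (by linarith)
  have hG : Real.logb 2 (1 + g₂) ≤ Real.logb 2 (1 + g₁) :=
    Real.logb_le_logb_of_le one_lt_two (by linarith) (by linarith)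
  have hD₁ : 0 ≤ Real.logb 2 (1 + d₁) := Real.logb_nonneg one_lt_two (by linarith)
  have hD₂ : 0 ≤ Real.logb 2 (1 + d₂) := Real.logb_nonneg one_lt_two (by linarith)
  have hS : 0 ≤ Real.logb 2 (1 + d₁ + d₂) := Real.logb_nonneg one_lt_two (by linarith)
  have hSD : Real.logb 2 (1 + d₁ + d₂) ≤ Real.logb 2 (1 + d₁) + Real.logb 2 (1 + d₂) := by
    rw [← Real.logb_mul (by positivity) (by positivity)]
    exact Real.logb_le_logb_of_le one_lt_two (by positivity)
      (by nlinarith [mul_nonneg hd₁ hd₂])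
  rw [max_eq_left hg]
  set M := min (min (Real.logb 2 (1 + g₁)) (Real.logb 2 (1 + d₁ + d₂)))
    (min (Real.logb 2 (1 + g₁) + Real.logb 2 (1 + d₂))
      (Real.logb 2 (1 + g₂) + Real.logb 2 (1 + d₁))) with hM
  have hM₀ : 0 ≤ M :=
    le_min (le_min (hG₂.trans hG) hS) (le_min (add_nonneg (hG₂.trans hG) hD₂) (add_nonneg hG₂ hD₁))
  obtain ⟨⟨hMG, hMS⟩, -, hMGD⟩ : (M ≤ Real.logb 2 (1 + g₁) ∧ M ≤ Real.logb 2 (1 + d₁ + d₂)) ∧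
      M ≤ Real.logb 2 (1 + g₁) + Real.logb 2 (1 + d₂) ∧
      M ≤ Real.logb 2 (1 + g₂) + Real.logb 2 (1 + d₁) := by
    simpa only [le_min_iff] using hM.le
  clear_value M
  refine ⟨(min M (Real.logb 2 (1 + d₁)), M - min M (Real.logb 2 (1 + d₁))), ?_, by simp⟩
  dsimp only [diamondRstar, Set.mem_ofPred_eq]
  rcases min_cases M (Real.logb 2 (1 + d₁)) with ⟨h, _⟩ | ⟨h, _⟩ <;> rw [h] <;>
    refine ⟨?_, ?_, ?_, ?_, ?_, ?_, ?_⟩ <;> linarith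
end

section
/- Let a₁, a₂, b₁, b₂ be nonnegative real numbers with a₁ ≥ a₂, and set g₁ = a₁², g₂ = a₂², d₁ = b₁², d₂ = b₂². Then there exists a pair (R₁, R₂) in the region 𝓡* with R₁ + R₂ ≥ min{ log₂(1 + g₁ + g₂), log₂(1 + (b₁ + b₂)²), log₂(1 + g₁) + log₂(1 + d₂), log₂(1 + g₂) + log₂(1 + d₁) } − 1. (That is, R* = sup{R₁+R₂ : (R₁,R₂) ∈ 𝓡*} is within one bit of the cut-set upper bound of the Gaussian diamond network.) -/
theorem exists_mem_diamondRstar_add_eq_min {g₁ g₂ d₁ d₂ : ℝ}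
    (hg₁ : 0 ≤ g₁) (hg₂ : 0 ≤ g₂) (hd₁ : 0 ≤ d₁) (hd₂ : 0 ≤ d₂) :
    ∃ p ∈ diamondRstar g₁ g₂ d₁ d₂, p.1 + p.2 =
      min (Real.logb 2 (1 + d₁) + min (Real.logb 2 (1 + g₂)) (Real.logb 2 (1 + d₂)))
        (min (Real.logb 2 (1 + g₁)) (Real.logb 2 (1 + d₁ + d₂))) := by
  have h_nonneg {x : ℝ} (hx : 0 ≤ x) : 0 ≤ Real.logb 2 (1 + x) :=
    Real.logb_nonneg one_lt_two (by linarith)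
  have hG₁ := h_nonneg hg₁
  have hm := le_min (h_nonneg hg₂) (h_nonneg hd₂)
  have hD₁ := h_nonneg hd₁
  have hD := h_nonneg (add_nonneg hd₁ hd₂)
  rw [← add_assoc] at hD
  have hs := le_min hG₁ hD
  obtain ⟨hmg, hmd⟩ := le_min_iff.mp
    (le_refl (min (Real.logb 2 (1 + g₂)) (Real.logb 2 (1 + d₂))))
  obtain ⟨hsg, hsd⟩ := le_min_iff.mp
    (le_refl (min (Real.logb 2 (1 + g₁)) (Real.logb 2 (1 + d₁ + d₂))))
  set m := min (Real.logb 2 (1 + g₂)) (Real.logb 2 (1 + d₂))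
  set s := min (Real.logb 2 (1 + g₁)) (Real.logb 2 (1 + d₁ + d₂))
  rcases le_total s (Real.logb 2 (1 + d₁)) with h | h
  · refine ⟨(s, 0), ⟨?_, ?_, ?_, ?_, ?_, ?_, ?_⟩, ?_⟩ <;> try (dsimp only; linarith)
    rw [min_eq_right (by linarith)]
    simp
  · rcases le_total (Real.logb 2 (1 + d₁) + m) s with h' | h'
    · refine ⟨(Real.logb 2 (1 + d₁), m), ⟨?_, ?_, ?_, ?_, ?_, ?_, ?_⟩, ?_⟩ <;>
        try (dsimp only; linarith)
      rw [min_eq_left h']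
    · refine ⟨(Real.logb 2 (1 + d₁), s - Real.logb 2 (1 + d₁)),
        ⟨?_, ?_, ?_, ?_, ?_, ?_, ?_⟩, ?_⟩ <;> try (dsimp only; linarith)
      rw [min_eq_right h']
      ring

theorem logb_two_sub_one_le {x y : ℝ} (hx : 0 < x) (hy : 0 < y) (h : x ≤ 2 * y) :
    Real.logb 2 x - 1 ≤ Real.logb 2 y := by
  have h_log := Real.logb_le_logb_of_le one_lt_two hx h
  rw [Real.logb_mul two_ne_zero hy.ne', Real.logb_self_eq_one one_lt_two] at h_log
  linarith

/-- R* is within one bit of the cut-set upper bound of the Gaussian diamond network. -/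
theorem diamondRstar_within_one_bit_of_cutset
    (a₁ a₂ b₁ b₂ : ℝ) (ha₂ : 0 ≤ a₂) (ha : a₂ ≤ a₁) (hb₁ : 0 ≤ b₁) (hb₂ : 0 ≤ b₂) :
    ∃ p ∈ diamondRstar (a₁ ^ 2) (a₂ ^ 2) (b₁ ^ 2) (b₂ ^ 2),
      min (min (Real.logb 2 (1 + a₁ ^ 2 + a₂ ^ 2)) (Real.logb 2 (1 + (b₁ + b₂) ^ 2)))
          (min (Real.logb 2 (1 + a₁ ^ 2) + Real.logb 2 (1 + b₂ ^ 2))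
            (Real.logb 2 (1 + a₂ ^ 2) + Real.logb 2 (1 + b₁ ^ 2))) - 1
        ≤ p.1 + p.2 := by
  obtain ⟨p, hp, h_sum⟩ := exists_mem_diamondRstar_add_eq_min
    (sq_nonneg a₁) (sq_nonneg a₂) (sq_nonneg b₁) (sq_nonneg b₂)
  refine ⟨p, hp, ?_⟩
  have h_source : Real.logb 2 (1 + a₁ ^ 2 + a₂ ^ 2) - 1 ≤ Real.logb 2 (1 + a₁ ^ 2) :=
    logb_two_sub_one_le (by positivity) (by positivity) (by nlinarith)
  have h_dest : Real.logb 2 (1 + (b₁ + b₂) ^ 2) - 1 ≤ Real.logb 2 (1 + b₁ ^ 2 + b₂ ^ 2) :=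
    logb_two_sub_one_le (by positivity) (by positivity) (by nlinarith [sq_nonneg (b₁ - b₂)])
  have h_mac : Real.logb 2 (1 + b₁ ^ 2 + b₂ ^ 2) ≤
      Real.logb 2 (1 + b₁ ^ 2) + Real.logb 2 (1 + b₂ ^ 2) := by
    rw [← Real.logb_mul (by positivity) (by positivity)]
    exact Real.logb_le_logb_of_le one_lt_two (by positivity)
      (by nlinarith [mul_nonneg (sq_nonneg b₁) (sq_nonneg b₂)])
  rw [h_sum, ← min_add_add_left, sub_le_iff_le_add]
  simp only [← sub_le_iff_le_add, le_min_iff]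
  simp only [sub_le_iff_le_add, min_le_iff]
  refine ⟨⟨?_, ?_⟩, ?_, ?_⟩
  · right; right; linarith
  · left; right; linarith
  · left; left; linarith
  · left; right; linarith
end

section
/- Let a₁, a₂, b₁, b₂ be nonnegative real numbers with a₁ ≥ a₂, and set g₁ = a₁², g₂ = a₂², d₁ = b₁², d₂ = b₂². Then there exists a pair (R₁, R₂) in the region 𝓡 with R₁ + R₂ ≥ min{ log₂(1 + g₁ + g₂), log₂(1 + (b₁ + b₂)²), log₂(1 + g₁) + log₂(1 + d₂), log₂(1 + g₂) + log₂(1 + d₁) } − 2. (That is, the partial decode-and-forward sum rate R_PDF of the Gaussian diamond network is within two bits of its cut-set upper bound, for all values of the channel gains.) -/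
/-- The region `diamondR` contains a pair of sum rate at least `logb 2 T` as soon as `T` is at most
half of `1 + g₁`, at most `1 + d₁ + d₂`, and at most a quarter of `(1 + g₂) * (1 + d₁)`. -/
theorem exists_mem_diamondR_logb_le_add {g₁ g₂ d₁ d₂ T : ℝ} (hg₂ : 0 ≤ g₂) (hg : g₂ ≤ g₁)
    (hd₁ : 0 ≤ d₁) (hd₂ : 0 ≤ d₂) (hT : 0 < T) (hTg : T ≤ (1 + g₁) / 2) (hTd : T ≤ 1 + d₁ + d₂)
    (hTgd : T ≤ (1 + g₂) * (1 + d₁) / 4) :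
    ∃ p ∈ diamondR g₁ g₂ d₁ d₂, Real.logb 2 T ≤ p.1 + p.2 := by
  have h2 : (1 : ℝ) < 2 := one_lt_two
  rcases le_or_gt T (1 + d₁) with h | h
  · refine ⟨(min (Real.logb 2 (1 + g₁)) (Real.logb 2 (1 + d₁)), 0),
      ⟨1, zero_le_one, le_rfl, ?_, ?_, le_rfl, ?_, ?_, ?_, ?_⟩, ?_⟩
    · exact le_min (Real.logb_nonneg h2 (by linarith)) (Real.logb_nonneg h2 (by linarith))
    · simp
    · simp
    · exact min_le_right _ _
    · exact Real.logb_nonneg h2 (by linarith)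
    · rw [add_zero]
      exact (min_le_right _ _).trans (Real.logb_le_logb_of_le h2 (by linarith) (by linarith))
    · rw [add_zero]
      exact le_min (Real.logb_le_logb_of_le h2 hT (by linarith))
        (Real.logb_le_logb_of_le h2 hT h)
  · have hu : 0 < 1 + d₁ := by linarith
    obtain ⟨q, rfl⟩ : ∃ q, T = q * (1 + d₁) := ⟨T / (1 + d₁), by field_simp⟩
    have hq : 1 < q := by
      by_contra! hq
      nlinarith
    have hqy : q ≤ (1 + g₂) / 4 := by
      by_contra! hqy
      nlinarith
    have hqv : q ≤ 1 + d₂ := by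
      by_contra! hqv
      nlinarith [mul_nonneg hd₁ hd₂]
    have hg₂' : 0 < g₂ := by linarith
    have hq0 : 0 < q := by linarith
    have hden : (1 + g₂ - q) / (q * g₂) * g₂ + 1 = (1 + g₂) / q := by
      field_simp
      ring
    have hα0 : 0 ≤ (1 + g₂ - q) / (q * g₂) := div_nonneg (by linarith) (by positivity)
    have hweak : 1 + (1 - (1 + g₂ - q) / (q * g₂)) * g₂ / ((1 + g₂) / q) = q := by
      field_simp
      ring
    have hstrong : 1 + d₁ ≤ 1 + (1 + g₂ - q) / (q * g₂) * g₁ := by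
      have h₁ : (3 / 4 * g₂) * g₁ ≤ (1 + g₂ - q) * g₁ :=
        mul_le_mul_of_nonneg_right (by linarith) (by linarith)
      have h₂ : d₁ * (q * g₂) ≤ (1 + g₂ - q) * g₁ := by
        have : (q * (1 + d₁) - q) * g₂ ≤ (3 / 4 * g₁) * g₂ :=
          mul_le_mul_of_nonneg_right (by linarith) hg₂
        linarith
      rw [div_mul_eq_mul_div]
      have := (le_div_iff₀ (mul_pos hq0 hg₂')).2 h₂
      linarith
    have hsum : Real.logb 2 (1 + d₁) + Real.logb 2 q = Real.logb 2 (q * (1 + d₁)) := by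
      rw [Real.logb_mul hq0.ne' hu.ne', add_comm]
    refine ⟨(Real.logb 2 (1 + d₁), Real.logb 2 q),
      ⟨(1 + g₂ - q) / (q * g₂), hα0, ?_, ?_, ?_, ?_, ?_, le_rfl, ?_, ?_⟩, hsum.ge⟩
    · rw [div_le_one (by positivity)]
      nlinarith
    · exact Real.logb_nonneg h2 (by linarith)
    · exact Real.logb_le_logb_of_le h2 hu hstrong
    · exact Real.logb_nonneg h2 hq.le
    · rw [hden, hweak]
    · exact Real.logb_le_logb_of_le h2 hq0 hqv
    · exact hsum.trans_le (Real.logb_le_logb_of_le h2 hT hTd)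

/-- The partial decode-and-forward sum rate of the Gaussian diamond network is
within two bits of its cut-set upper bound. -/
theorem diamond_pdf_within_two_bits_of_cutset
    (a₁ a₂ b₁ b₂ : ℝ) (ha₂ : 0 ≤ a₂) (ha : a₂ ≤ a₁) (hb₁ : 0 ≤ b₁) (hb₂ : 0 ≤ b₂) :
    ∃ p ∈ diamondR (a₁ ^ 2) (a₂ ^ 2) (b₁ ^ 2) (b₂ ^ 2),
      min (min (Real.logb 2 (1 + a₁ ^ 2 + a₂ ^ 2)) (Real.logb 2 (1 + (b₁ + b₂) ^ 2)))
          (min (Real.logb 2 (1 + a₁ ^ 2) + Real.logb 2 (1 + b₂ ^ 2))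
            (Real.logb 2 (1 + a₂ ^ 2) + Real.logb 2 (1 + b₁ ^ 2))) - 2
        ≤ p.1 + p.2 := by
  set M := min (min (Real.logb 2 (1 + a₁ ^ 2 + a₂ ^ 2)) (Real.logb 2 (1 + (b₁ + b₂) ^ 2)))
    (min (Real.logb 2 (1 + a₁ ^ 2) + Real.logb 2 (1 + b₂ ^ 2))
      (Real.logb 2 (1 + a₂ ^ 2) + Real.logb 2 (1 + b₁ ^ 2)))
  have key {X : ℝ} (hX : 0 < X) (h : M ≤ Real.logb 2 X) : (2 : ℝ) ^ (M - 2) ≤ X / 4 := by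
    rw [Real.le_logb_iff_rpow_le one_lt_two hX] at h
    rw [Real.rpow_sub two_pos, Real.rpow_two]
    linarith
  have hbc := key (X := 1 + a₁ ^ 2 + a₂ ^ 2) (by positivity)
    ((min_le_left _ _).trans (min_le_left _ _))
  have hmac := key (X := 1 + (b₁ + b₂) ^ 2) (by positivity)
    ((min_le_left _ _).trans (min_le_right _ _))
  have hcross := key (X := (1 + a₂ ^ 2) * (1 + b₁ ^ 2)) (by positivity) <| by
    rw [Real.logb_mul (by positivity) (by positivity)]
    exact (min_le_right _ _).trans (min_le_right _ _)
  have haa : a₂ ^ 2 ≤ a₁ ^ 2 := by gcongr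
  obtain ⟨p, hp, hle⟩ := exists_mem_diamondR_logb_le_add (sq_nonneg a₂) haa (sq_nonneg b₁)
    (sq_nonneg b₂) (Real.rpow_pos_of_pos two_pos (M - 2)) (by linarith)
    (by nlinarith [sq_nonneg (b₁ - b₂)]) hcross
  refine ⟨p, hp, ?_⟩
  rwa [Real.logb_rpow two_pos (by norm_num)] at hle
end

section
/- Let SNR₁ ≥ SNR₂ ≥ 1 be real numbers and set n₁ = ⌈log₂ SNR₁⌉ and n₂ = ⌈log₂ SNR₂⌉. Suppose the pair (R₁, R₂) of real numbers satisfies 0 ≤ R₁, 0 ≤ R₂ ≤ n₂ and R₁ + R₂ ≤ n₁ (i.e., it lies in the capacity region of the deterministic multiple access channel). Then the pair (max(R₁ − 1, 0), max(R₂ − 1, 0)) satisfies max(R₁ − 1, 0) ≤ log₂(1 + SNR₁), max(R₂ − 1, 0) ≤ log₂(1 + SNR₂) and max(R₁ − 1, 0) + max(R₂ − 1, 0) ≤ log₂(1 + SNR₁ + SNR₂) (i.e., it lies in the capacity region of the Gaussian multiple access channel). Thus the capacity region of the deterministic MAC is within one bit per user of the capacity region of the Gaussian MAC. -/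
/-- The capacity region of the deterministic MAC is within one bit per user of
the capacity region of the Gaussian MAC. -/
theorem det_mac_within_one_bit_of_gaussian_mac
    (SNR₁ SNR₂ : ℝ) (h₂ : 1 ≤ SNR₂) (h₁₂ : SNR₂ ≤ SNR₁)
    (R₁ R₂ : ℝ) (hR₁ : 0 ≤ R₁) (hR₂ : 0 ≤ R₂)
    (hR₂n : R₂ ≤ (⌈Real.logb 2 SNR₂⌉ : ℝ))
    (hsum : R₁ + R₂ ≤ (⌈Real.logb 2 SNR₁⌉ : ℝ)) :
    max (R₁ - 1) 0 ≤ Real.logb 2 (1 + SNR₁) ∧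
    max (R₂ - 1) 0 ≤ Real.logb 2 (1 + SNR₂) ∧
    max (R₁ - 1) 0 + max (R₂ - 1) 0 ≤ Real.logb 2 (1 + SNR₁ + SNR₂) := by
  have hceil₁ := Int.ceil_lt_add_one (Real.logb 2 SNR₁)
  have hceil₂ := Int.ceil_lt_add_one (Real.logb 2 SNR₂)
  have hlog₁ : 0 ≤ Real.logb 2 SNR₁ := Real.logb_nonneg one_lt_two (h₂.trans h₁₂)
  have hlog₂ : 0 ≤ Real.logb 2 SNR₂ := Real.logb_nonneg one_lt_two h₂
  have hmono₁ : Real.logb 2 SNR₁ ≤ Real.logb 2 (1 + SNR₁) :=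
    Real.logb_le_logb_of_le one_lt_two (by linarith) (by linarith)
  have hmono₂ : Real.logb 2 SNR₂ ≤ Real.logb 2 (1 + SNR₂) :=
    Real.logb_le_logb_of_le one_lt_two (by linarith) (by linarith)
  have hmono_sum : Real.logb 2 SNR₁ ≤ Real.logb 2 (1 + SNR₁ + SNR₂) :=
    Real.logb_le_logb_of_le one_lt_two (by linarith) (by linarith)
  refine ⟨max_le (by linarith) (by linarith), max_le (by linarith) (by linarith), ?_⟩
  rcases max_cases (R₁ - 1) 0 with ⟨h, _⟩ | ⟨h, _⟩ <;>
    rcases max_cases (R₂ - 1) 0 with ⟨h', _⟩ | ⟨h', _⟩ <;>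
    rw [h, h'] <;> linarith
end

section
/- Let SNR₁ ≥ SNR₂ ≥ 1 be real numbers. Suppose the pair (R₁, R₂) of real numbers satisfies 0 ≤ R₁, 0 ≤ R₂ ≤ log₂ SNR₂ and R₁ + R₂ ≤ log₂ SNR₁ (i.e., it lies in the capacity region of the deterministic broadcast channel with gains n₁ = log₂ SNR₁ and n₂ = log₂ SNR₂). Then there exists α ∈ [0,1] such that max(R₁ − 1, 0) ≤ log₂(1 + α·SNR₁) and max(R₂ − 1, 0) ≤ log₂(1 + (1 − α)·SNR₂ / (α·SNR₂ + 1)). Thus every rate pair in the deterministic broadcast region is within one bit per component of a rate pair in the Gaussian broadcast capacity region. -/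
/-- Every rate pair in the deterministic broadcast region is within one bit per
component of a rate pair in the Gaussian broadcast capacity region. -/
theorem det_bc_within_one_bit_of_gaussian_bc
    (SNR₁ SNR₂ : ℝ) (h₂ : 1 ≤ SNR₂) (h₁₂ : SNR₂ ≤ SNR₁)
    (R₁ R₂ : ℝ) (hR₁ : 0 ≤ R₁) (hR₂ : 0 ≤ R₂)
    (hR₂n : R₂ ≤ Real.logb 2 SNR₂)
    (hsum : R₁ + R₂ ≤ Real.logb 2 SNR₁) :
    ∃ α : ℝ, 0 ≤ α ∧ α ≤ 1 ∧
      max (R₁ - 1) 0 ≤ Real.logb 2 (1 + α * SNR₁) ∧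
      max (R₂ - 1) 0 ≤ Real.logb 2 (1 + (1 - α) * SNR₂ / (α * SNR₂ + 1)) := by
  have hS₂ : 0 < SNR₂ := by linarith
  have hS₁ : 0 < SNR₁ := by linarith
  have hx : 0 < (2 : ℝ) ^ R₁ := by positivity
  have hy : 1 ≤ (2 : ℝ) ^ R₂ := Real.one_le_rpow (by norm_num) hR₂
  have hyS : (2 : ℝ) ^ R₂ ≤ SNR₂ := (Real.le_logb_iff_rpow_le (by norm_num) hS₂).1 hR₂n
  have hxy : (2 : ℝ) ^ R₁ * 2 ^ R₂ ≤ SNR₁ := by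
    rw [← Real.rpow_add (by norm_num)]
    exact (Real.le_logb_iff_rpow_le (by norm_num) hS₁).1 hsum
  have half (r : ℝ) : (2 : ℝ) ^ (r - 1) = 2 ^ r / 2 := by
    rw [Real.rpow_sub_one (by norm_num)]
  generalize hX : (2 : ℝ) ^ R₁ = x at *
  generalize hY : (2 : ℝ) ^ R₂ = y at *
  have hy0 : 0 < y := by linarith
  have hrate : 1 + (1 - 1 / y) * SNR₂ / (1 / y * SNR₂ + 1) = y * (1 + SNR₂) / (y + SNR₂) := by
    field_simp
    ring
  have hquot : x ≤ 1 / y * SNR₁ := by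
    rw [one_div_mul_eq_div, le_div_iff₀ hy0]
    exact hxy
  refine ⟨1 / y, by positivity, (div_le_one hy0).2 hy, max_le ?_ ?_, max_le ?_ ?_⟩
  · rw [Real.le_logb_iff_rpow_le (by norm_num) (by positivity), half, hX]
    linarith
  · exact Real.logb_nonneg (by norm_num) (by linarith)
  · rw [hrate, Real.le_logb_iff_rpow_le (by norm_num) (by positivity), half, hY,
      le_div_iff₀ (by positivity)]
    nlinarith
  · rw [hrate]
    refine Real.logb_nonneg (by norm_num) ?_
    rw [le_div_iff₀ (by positivity)]
    nlinarith
end
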